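/- Let (U*, V*) be a balanced factorization of a rank-r matrix X* ∈ ℝ^{m×n}, with W* = [U*; V*] and W̃* = [U*; −V*]. Let W = [U; V] ∈ ℝ^{(m+n)×r} have full column rank with QR decomposition W = QR (Q ∈ ℝ^{(m+n)×r} with orthonormal columns, R ∈ ℝ^{r×r} invertible upper triangular), and set Z = (WWᵀ − W*W*ᵀ)·Q·R^{−ᵀ}, so that ZWᵀ = (WWᵀ − W*W*ᵀ)·QQᵀ. Writing Z = [Z_U; Z_V] with Z_U ∈ ℝ^{m×r}, Z_V ∈ ℝ^{n×r}, then 2·⟨UVᵀ − U*V*ᵀ, Z_UVᵀ + UZ_Vᵀ⟩ + ⟨W̃W̃ᵀ, ZWᵀ⟩ ≥ ‖(WWᵀ − W*W*ᵀ)·QQᵀ‖_F². -/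

import Mathlib

open Matrix BigOperators

noncomputable section

/-- Trace inner product `⟨X, Y⟩ = trace (Xᵀ * Y) = ∑ᵢⱼ Xᵢⱼ Yᵢⱼ`. -/
def ip {α β : Type*} [Fintype α] [Fintype β] (X Y : Matrix α β ℝ) : ℝ :=
  ∑ i, ∑ j, X i j * Y i j

/-- Frobenius norm. -/
def fnorm {α β : Type*} [Fintype α] [Fintype β] (X : Matrix α β ℝ) : ℝ :=
  Real.sqrt (∑ i, ∑ j, X i j ^ 2)

/-- Euclidean (ℓ₂) norm of a vector. -/
def vnorm {α : Type*} [Fintype α] (x : α → ℝ) : ℝ :=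
  Real.sqrt (∑ i, x i ^ 2)

/-- The linear operator `𝒜(X)ᵢ = ⟨Aᵢ, X⟩` satisfies the restricted isometry property on
rank-`k` matrices with parameter `δ`. -/
def RIP {m n p : ℕ} (A : Fin p → Matrix (Fin m) (Fin n) ℝ) (k : ℕ) (δ : ℝ) : Prop :=
  ∀ X : Matrix (Fin m) (Fin n) ℝ, X.rank ≤ k →
    (1 - δ) * fnorm X ^ 2 ≤ ∑ i, ip (A i) X ^ 2 ∧
      ∑ i, ip (A i) X ^ 2 ≤ (1 + δ) * fnorm X ^ 2

/-- Vertical stacking `[U; V]`. -/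
def stack {m n r : ℕ} (U : Matrix (Fin m) (Fin r) ℝ) (V : Matrix (Fin n) (Fin r) ℝ) :
    Matrix (Fin m ⊕ Fin n) (Fin r) ℝ :=
  Matrix.fromRows U V

/-- For `Z = [Z_U; Z_V]`, `tilde Z = [Z_U; -Z_V]` (negate the bottom block). -/
def tilde {m n r : ℕ} (Z : Matrix (Fin m ⊕ Fin n) (Fin r) ℝ) :
    Matrix (Fin m ⊕ Fin n) (Fin r) ℝ :=
  Matrix.of (Sum.elim (fun i j => Z (Sum.inl i) j) (fun i j => -Z (Sum.inr i) j))

/-- `Bᵢ = (1/2) · [[0, Aᵢ], [Aᵢᵀ, 0]]`. -/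
def Bmat {m n p : ℕ} (A : Fin p → Matrix (Fin m) (Fin n) ℝ) (i : Fin p) :
    Matrix (Fin m ⊕ Fin n) (Fin m ⊕ Fin n) ℝ :=
  (1 / 2 : ℝ) • Matrix.fromBlocks 0 (A i) (A i)ᵀ 0

/-- `(U, V)` is a balanced ("equally-footed") factorization of `X`: for some SVD
`X = A · diagonal S · Bᵀ` (with `A, B` having orthonormal columns and `S` the nonnegative
singular values) and some orthonormal `R`, `U = A · S^{1/2} · R` and `V = B · S^{1/2} · R`. -/
def IsBalanced {m n r : ℕ} (X : Matrix (Fin m) (Fin n) ℝ)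
    (U : Matrix (Fin m) (Fin r) ℝ) (V : Matrix (Fin n) (Fin r) ℝ) : Prop :=
  ∃ (A : Matrix (Fin m) (Fin r) ℝ) (B : Matrix (Fin n) (Fin r) ℝ)
    (S : Fin r → ℝ) (R : Matrix (Fin r) (Fin r) ℝ),
      Aᵀ * A = 1 ∧ Bᵀ * B = 1 ∧ (∀ i, 0 ≤ S i) ∧ Rᵀ * R = 1 ∧ R * Rᵀ = 1 ∧
      X = A * Matrix.diagonal S * Bᵀ ∧
      U = A * Matrix.diagonal (fun i => Real.sqrt (S i)) * R ∧
      V = B * Matrix.diagonal (fun i => Real.sqrt (S i)) * R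

/-- `Dist(U, V; X) = min ‖[U; V] − [U*; V*]‖_F` over balanced factorizations `(U*, V*)` of `X`. -/
def distW {m n r : ℕ} (U : Matrix (Fin m) (Fin r) ℝ) (V : Matrix (Fin n) (Fin r) ℝ)
    (X : Matrix (Fin m) (Fin n) ℝ) : ℝ :=
  sInf {d : ℝ | ∃ (U' : Matrix (Fin m) (Fin r) ℝ) (V' : Matrix (Fin n) (Fin r) ℝ),
    IsBalanced X U' V' ∧ d = fnorm (stack U V - stack U' V')}

/-- First-order optimality condition for `f + g` at `W = [U; V]`:
`∑ᵢ (⟨Bᵢ, WWᵀ⟩ − bᵢ) Bᵢ W + (1/4) W̃ W̃ᵀ W = 0`. -/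
def FirstOrderOpt {m n r p : ℕ} (A : Fin p → Matrix (Fin m) (Fin n) ℝ) (b : Fin p → ℝ)
    (U : Matrix (Fin m) (Fin r) ℝ) (V : Matrix (Fin n) (Fin r) ℝ) : Prop :=
  (∑ i, (ip (Bmat A i) (stack U V * (stack U V)ᵀ) - b i) • (Bmat A i * stack U V))
    + (1 / 4 : ℝ) • (stack U (-V) * (stack U (-V))ᵀ * stack U V) = 0

/-- The Hessian quadratic form of `f + g` at `W = [U; V]` in direction `Z`. -/
def hessForm {m n r p : ℕ} (A : Fin p → Matrix (Fin m) (Fin n) ℝ) (b : Fin p → ℝ)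
    (U : Matrix (Fin m) (Fin r) ℝ) (V : Matrix (Fin n) (Fin r) ℝ)
    (Z : Matrix (Fin m ⊕ Fin n) (Fin r) ℝ) : ℝ :=
  (∑ i, ip (Bmat A i) (Z * (stack U V)ᵀ + stack U V * Zᵀ) * ip (Bmat A i) (Z * (stack U V)ᵀ))
    + (∑ i, (ip (Bmat A i) (stack U V * (stack U V)ᵀ) - b i) * ip (Bmat A i) (Z * Zᵀ))
    + (1 / 4 : ℝ) * ip (tilde Z * (stack U (-V))ᵀ + stack U (-V) * (tilde Z)ᵀ)
        (Z * (stack U V)ᵀ)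
    + (1 / 4 : ℝ) * ip (stack U (-V) * (stack U (-V))ᵀ) (Z * Zᵀ)

/-- Second-order optimality condition for `f + g` at `W = [U; V]`: the Hessian quadratic
form is nonnegative in every direction `Z = [Z_U; Z_V]`. -/
def SecondOrderOpt {m n r p : ℕ} (A : Fin p → Matrix (Fin m) (Fin n) ℝ) (b : Fin p → ℝ)
    (U : Matrix (Fin m) (Fin r) ℝ) (V : Matrix (Fin n) (Fin r) ℝ) : Prop :=
  ∀ Z : Matrix (Fin m ⊕ Fin n) (Fin r) ℝ, 0 ≤ hessForm A b U V Z

theorem ip_eq_trace {α β : Type*} [Fintype α] [Fintype β] (X Y : Matrix α β ℝ) :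
    ip X Y = (Xᵀ * Y).trace := by
  simp only [ip, Matrix.trace, Matrix.diag, Matrix.mul_apply, Matrix.transpose_apply]
  exact Finset.sum_comm

theorem ip_add_right {α β : Type*} [Fintype α] [Fintype β] (X Y Z : Matrix α β ℝ) :
    ip X (Y + Z) = ip X Y + ip X Z := by
  simp [ip_eq_trace, Matrix.mul_add]

theorem ip_sub_left {α β : Type*} [Fintype α] [Fintype β] (X Y Z : Matrix α β ℝ) :
    ip (X - Y) Z = ip X Z - ip Y Z := by
  simp [ip_eq_trace, Matrix.sub_mul]

theorem ip_self_nonneg {α β : Type*} [Fintype α] [Fintype β] (X : Matrix α β ℝ) :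
    0 ≤ ip X X :=
  Finset.sum_nonneg fun _ _ => Finset.sum_nonneg fun _ _ => mul_self_nonneg _

theorem fnorm_sq {α β : Type*} [Fintype α] [Fintype β] (X : Matrix α β ℝ) :
    fnorm X ^ 2 = ip X X := by
  have h : 0 ≤ ∑ i, ∑ j, X i j ^ 2 :=
    Finset.sum_nonneg fun _ _ => Finset.sum_nonneg fun _ _ => sq_nonneg _
  refine (Real.sq_sqrt h).trans ?_
  simp only [ip, sq]

theorem ip_transpose {α β : Type*} [Fintype α] [Fintype β] (X Y : Matrix α β ℝ) :
    ip Xᵀ Yᵀ = ip X Y := by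
  simp only [ip, Matrix.transpose_apply]
  exact Finset.sum_comm

theorem ip_fromBlocks {m n : ℕ} (A A' : Matrix (Fin m) (Fin m) ℝ) (B B' : Matrix (Fin m) (Fin n) ℝ)
    (C C' : Matrix (Fin n) (Fin m) ℝ) (D D' : Matrix (Fin n) (Fin n) ℝ) :
    ip (Matrix.fromBlocks A B C D) (Matrix.fromBlocks A' B' C' D')
      = ip A A' + ip B B' + ip C C' + ip D D' := by
  simp only [ip, Fintype.sum_sum_type, Matrix.fromBlocks_apply₁₁, Matrix.fromBlocks_apply₁₂,
    Matrix.fromBlocks_apply₂₁, Matrix.fromBlocks_apply₂₂, Finset.sum_add_distrib]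
  ring

theorem stack_mul_stack_transpose {m n r : ℕ} (U U' : Matrix (Fin m) (Fin r) ℝ)
    (V V' : Matrix (Fin n) (Fin r) ℝ) :
    stack U V * (stack U' V')ᵀ
      = Matrix.fromBlocks (U * U'ᵀ) (U * V'ᵀ) (V * U'ᵀ) (V * V'ᵀ) := by
  rw [stack, stack, Matrix.transpose_fromRows, Matrix.fromRows_mul_fromCols]

/-- The off-diagonal blocks of `WWᵀ - W'W'ᵀ` are half the difference between this matrix and its
conjugate by `diag (1, -1)`. -/
theorem two_mul_ip_off_diagonal {m n r : ℕ} (U Us ZU : Matrix (Fin m) (Fin r) ℝ)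
    (V Vs ZV : Matrix (Fin n) (Fin r) ℝ) :
    2 * ip (U * Vᵀ - Us * Vsᵀ) (ZU * Vᵀ + U * ZVᵀ)
      = ip (stack U V * (stack U V)ᵀ - stack Us Vs * (stack Us Vs)ᵀ)
            (stack ZU ZV * (stack U V)ᵀ)
        - (ip (stack U (-V) * (stack U (-V))ᵀ) (stack ZU ZV * (stack U V)ᵀ)
          - ip (stack Us (-Vs) * (stack Us (-Vs))ᵀ) (stack ZU ZV * (stack U V)ᵀ)) := by
  have h : ip (U * Vᵀ - Us * Vsᵀ) (U * ZVᵀ) = ip (V * Uᵀ - Vs * Usᵀ) (ZV * Uᵀ) := by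
    rw [← ip_transpose]
    simp
  have neg_left {k l : ℕ} (X Y : Matrix (Fin k) (Fin l) ℝ) : ip (-X) Y = -ip X Y := by
    simp [ip]
  rw [ip_add_right, h]
  simp only [stack_mul_stack_transpose, ip_sub_left, ip_fromBlocks, Matrix.transpose_neg,
    Matrix.mul_neg, Matrix.neg_mul, neg_neg, neg_left]
  ring

theorem IsBalanced.stack_neg_transpose_mul_stack {m n r : ℕ} {X : Matrix (Fin m) (Fin n) ℝ}
    {U : Matrix (Fin m) (Fin r) ℝ} {V : Matrix (Fin n) (Fin r) ℝ} (h : IsBalanced X U V) :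
    (stack U (-V))ᵀ * stack U V = 0 := by
  obtain ⟨A, B, S, R, hA, hB, -, -, -, -, rfl, rfl⟩ := h
  have gram {k : ℕ} (C : Matrix (Fin k) (Fin r) ℝ) (D : Matrix (Fin r) (Fin r) ℝ)
      (hC : Cᵀ * C = 1) : (C * D * R)ᵀ * (C * D * R) = Rᵀ * (Dᵀ * D) * R := by
    calc (C * D * R)ᵀ * (C * D * R) = Rᵀ * (Dᵀ * ((Cᵀ * C) * D)) * R := by
          simp only [Matrix.transpose_mul, Matrix.mul_assoc]
      _ = _ := by rw [hC, Matrix.one_mul]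
  rw [stack, stack, Matrix.transpose_fromRows, Matrix.fromCols_mul_fromRows,
    Matrix.transpose_neg, Matrix.neg_mul, gram A _ hA, gram B _ hB, add_neg_cancel]

theorem ip_gram_gram {α β γ : Type*} [Fintype α] [Fintype β] [Fintype γ]
    (M : Matrix α β ℝ) (N : Matrix α γ ℝ) :
    ip (M * Mᵀ) (N * Nᵀ) = ip (Mᵀ * N) (Mᵀ * N) := by
  rw [ip_eq_trace, ip_eq_trace, Matrix.transpose_mul, Matrix.transpose_mul,
    Matrix.transpose_transpose, ← Matrix.mul_assoc, Matrix.trace_mul_comm]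
  simp only [Matrix.mul_assoc]

theorem ip_mul_projection_self {α β : Type*} [Fintype α] [Fintype β] [DecidableEq β]
    (D : Matrix α α ℝ) {Q : Matrix α β ℝ} (hQ : Qᵀ * Q = 1) :
    ip (D * (Q * Qᵀ)) (D * (Q * Qᵀ)) = ip D (D * (Q * Qᵀ)) := by
  have hP : Q * Qᵀ * (Q * Qᵀ) = Q * Qᵀ := by
    rw [Matrix.mul_assoc, ← Matrix.mul_assoc Qᵀ, hQ, Matrix.one_mul]
  rw [ip_eq_trace, ip_eq_trace, Matrix.transpose_mul, Matrix.mul_assoc, Matrix.trace_mul_comm,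
    Matrix.transpose_mul, Matrix.transpose_transpose, Matrix.mul_assoc, Matrix.mul_assoc, hP]

/-- with `W = QR` the QR decomposition of the full-column-rank `W = [U; V]`
and `Z = (WWᵀ − W*W*ᵀ) Q R⁻ᵀ = [Z_U; Z_V]` (so `ZWᵀ = (WWᵀ − W*W*ᵀ) QQᵀ`):
`2⟨UVᵀ − U*V*ᵀ, Z_UVᵀ + UZ_Vᵀ⟩ + ⟨W̃W̃ᵀ, ZWᵀ⟩ ≥ ‖(WWᵀ − W*W*ᵀ)QQᵀ‖_F²`. -/
theorem qr_projection_lower_bound {m n r : ℕ}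
    (X : Matrix (Fin m) (Fin n) ℝ) (hrank : X.rank = r)
    (Us : Matrix (Fin m) (Fin r) ℝ) (Vs : Matrix (Fin n) (Fin r) ℝ)
    (hbal : IsBalanced X Us Vs)
    (U : Matrix (Fin m) (Fin r) ℝ) (V : Matrix (Fin n) (Fin r) ℝ)
    (hfull : (stack U V).rank = r)
    (Q : Matrix (Fin m ⊕ Fin n) (Fin r) ℝ) (R : Matrix (Fin r) (Fin r) ℝ)
    (hQ : Qᵀ * Q = 1) (hRtri : ∀ i j : Fin r, j < i → R i j = 0)
    (hRinv : IsUnit R.det)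
    (hQR : stack U V = Q * R)
    (Z : Matrix (Fin m ⊕ Fin n) (Fin r) ℝ)
    (hZ : Z = (stack U V * (stack U V)ᵀ - stack Us Vs * (stack Us Vs)ᵀ) * Q * (R⁻¹)ᵀ)
    (ZU : Matrix (Fin m) (Fin r) ℝ) (ZV : Matrix (Fin n) (Fin r) ℝ)
    (hZU : ZU = fun i j => Z (Sum.inl i) j) (hZV : ZV = fun i j => Z (Sum.inr i) j) :
    2 * ip (U * Vᵀ - Us * Vsᵀ) (ZU * Vᵀ + U * ZVᵀ)
        + ip (stack U (-V) * (stack U (-V))ᵀ) (Z * (stack U V)ᵀ)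
      ≥ fnorm ((stack U V * (stack U V)ᵀ - stack Us Vs * (stack Us Vs)ᵀ) * (Q * Qᵀ)) ^ 2 := by
  set D := stack U V * (stack U V)ᵀ - stack Us Vs * (stack Us Vs)ᵀ with hD
  have hZW : Z * (stack U V)ᵀ = D * (Q * Qᵀ) := by
    have hR : (R⁻¹)ᵀ * Rᵀ = 1 := by
      rw [← Matrix.transpose_mul, Matrix.mul_nonsing_inv R hRinv, Matrix.transpose_one]
    rw [hZ, hQR, Matrix.transpose_mul, Matrix.mul_assoc (D * Q), ← Matrix.mul_assoc (R⁻¹)ᵀ, hR,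
      Matrix.one_mul, Matrix.mul_assoc]
  have hZs : Z = stack ZU ZV := by
    subst hZU hZV
    ext (i | i) j <;> rfl
  have hWP : stack U V * (stack U V)ᵀ * (Q * Qᵀ) = stack U V * (stack U V)ᵀ := by
    rw [hQR, Matrix.transpose_mul]
    calc Q * R * (Rᵀ * Qᵀ) * (Q * Qᵀ) = Q * R * (Rᵀ * ((Qᵀ * Q) * Qᵀ)) := by
          simp only [Matrix.mul_assoc]
      _ = _ := by rw [hQ, Matrix.one_mul]
  have hcross : ip (stack Us (-Vs) * (stack Us (-Vs))ᵀ) (D * (Q * Qᵀ))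
      = ip ((stack Us (-Vs))ᵀ * stack U V) ((stack Us (-Vs))ᵀ * stack U V) := by
    have hzero : (stack Us (-Vs) * (stack Us (-Vs))ᵀ)ᵀ
        * (stack Us Vs * (stack Us Vs)ᵀ * (Q * Qᵀ)) = 0 := by
      rw [Matrix.transpose_mul, Matrix.transpose_transpose, Matrix.mul_assoc,
        Matrix.mul_assoc (stack Us Vs), ← Matrix.mul_assoc _ (stack Us Vs),
        hbal.stack_neg_transpose_mul_stack, Matrix.zero_mul, Matrix.mul_zero]
    rw [← ip_gram_gram, ip_eq_trace, hD, Matrix.sub_mul, Matrix.mul_sub, hzero, sub_zero, hWP,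
      ← ip_eq_trace]
  have hnonneg := ip_self_nonneg ((stack Us (-Vs))ᵀ * stack U V)
  rw [two_mul_ip_off_diagonal U Us ZU V Vs ZV, ← hZs, hZW, ← hD, fnorm_sq,
    ip_mul_projection_self D hQ, hcross]
  linarith
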